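/- Suppose γ < 1/( L(B/2)(n+1) + L + (L/2)nB ). Then for all t ≥ B and all positive integers k, with α(t) = f(x(t)) − f* and β(t) = γ² Σ_{τ=t−B}^{t−1} ‖s(τ)‖², one has α(t + kB) ≤ α(t) + (L/2)nB β(t) + ( L((B/2)(n+1) + 1) − γ^{-1} + (L/2)nB ) β(t+B). -/

import Mathlib

open scoped BigOperators
open Classical

theorem le_add_inner_gradient_add_sq {E : Type*} [NormedAddCommGroup E] [InnerProductSpace ℝ E]
    [CompleteSpace E] {f : E → ℝ} {L : ℝ} (hL : 0 ≤ L) (hf : Differentiable ℝ f)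
    (hLip : ∀ y z, ‖gradient f z - gradient f y‖ ≤ L * ‖z - y‖) (x d : E) :
    f (x + d) ≤ f x + inner ℝ (gradient f x) d + L * ‖d‖ ^ 2 := by
  have hderiv : ∀ θ : ℝ, HasDerivAt (fun θ : ℝ => f (x + θ • d))
      (inner ℝ (gradient f (x + θ • d)) d) θ := by
    intro θ
    have h1 : HasDerivAt (fun θ : ℝ => x + θ • d) d θ := by
      simpa using ((hasDerivAt_id θ).smul_const d).const_add x
    have h2 := (hf (x + θ • d)).hasGradientAt.hasFDerivAt.comp_hasDerivAt θ h1
    rwa [InnerProductSpace.toDual_apply_apply] at h2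
  obtain ⟨θ, hθ, h⟩ := exists_hasDerivAt_eq_slope (fun θ : ℝ => f (x + θ • d)) _ zero_lt_one
    (fun θ _ => (hderiv θ).continuousAt.continuousWithinAt) (fun θ _ => hderiv θ)
  simp only [one_smul, zero_smul, add_zero, sub_zero, div_one] at h
  have h3 : inner ℝ (gradient f (x + θ • d) - gradient f x) d ≤ L * ‖d‖ ^ 2 := by
    have hg := hLip x (x + θ • d)
    rw [add_sub_cancel_left, norm_smul, Real.norm_of_nonneg hθ.1.le] at hg
    have hθd : θ * ‖d‖ ≤ ‖d‖ := mul_le_of_le_one_left (norm_nonneg _) hθ.2.le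
    calc _ ≤ ‖gradient f (x + θ • d) - gradient f x‖ * ‖d‖ := real_inner_le_norm _ _
      _ ≤ (L * ‖d‖) * ‖d‖ := by
        gcongr
        exact hg.trans (by gcongr)
      _ = L * ‖d‖ ^ 2 := by ring
  rw [inner_sub_left] at h3
  linarith

theorem EuclideanSpace.norm_le_sum_norm_of_abs_le {ι κ : Type*} [Fintype ι] (S : Finset κ)
    (d : EuclideanSpace ℝ ι) (u : κ → EuclideanSpace ℝ ι)
    (h : ∀ c, |d c| ≤ ∑ r ∈ S, |u r c|) : ‖d‖ ≤ ∑ r ∈ S, ‖u r‖ := by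
  let w : κ → EuclideanSpace ℝ ι := fun r => WithLp.toLp 2 fun c => |u r c|
  have hw : ∀ r, ‖w r‖ = ‖u r‖ := fun r => by simp [w, EuclideanSpace.norm_eq]
  calc ‖d‖ ≤ ‖∑ r ∈ S, w r‖ := by
        rw [EuclideanSpace.norm_eq, EuclideanSpace.norm_eq]
        refine Real.sqrt_le_sqrt (Finset.sum_le_sum fun c _ => ?_)
        have hc : (∑ r ∈ S, w r) c = ∑ r ∈ S, |u r c| := by simp [w]
        rw [hc, Real.norm_eq_abs, Real.norm_eq_abs]
        exact pow_le_pow_left₀ (abs_nonneg _) ((h c).trans (le_abs_self _)) 2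
    _ ≤ ∑ r ∈ S, ‖w r‖ := norm_sum_le _ _
    _ = ∑ r ∈ S, ‖u r‖ := Finset.sum_congr rfl fun r _ => hw r

/-- The vector agreeing with `v` on block `i` and vanishing on the other blocks. -/
noncomputable def blockRestrict {m n : ℕ} (blk : Fin m → Fin n) (i : Fin n)
    (v : EuclideanSpace ℝ (Fin m)) : EuclideanSpace ℝ (Fin m) :=
  WithLp.toLp 2 fun c => if blk c = i then v c else 0

theorem sum_inner_blockRestrict {m n : ℕ} (blk : Fin m → Fin n)
    (G : Fin n → EuclideanSpace ℝ (Fin m)) (v : EuclideanSpace ℝ (Fin m)) :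
    ∑ i, inner ℝ (G i) (blockRestrict blk i v) = ∑ c, G (blk c) c * v c := by
  simp only [PiLp.inner_apply, blockRestrict]
  rw [Finset.sum_comm]
  refine Finset.sum_congr rfl fun c _ => ?_
  rw [Finset.sum_eq_single (blk c)]
  · simp [mul_comm]
  · intro i _ hi
    simp [hi.symm]
  · simp

theorem sum_norm_sq_blockRestrict {m n : ℕ} (blk : Fin m → Fin n)
    (v : EuclideanSpace ℝ (Fin m)) :
    ∑ i, ‖blockRestrict blk i v‖ ^ 2 = ‖v‖ ^ 2 := by
  simp only [EuclideanSpace.norm_sq_eq, blockRestrict]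
  rw [Finset.sum_comm]
  refine Finset.sum_congr rfl fun c _ => ?_
  rw [Finset.sum_eq_single (blk c)]
  · simp
  · intro i _ hi
    simp [hi.symm]
  · simp

theorem sum_window_sums_le {b : ℕ → ℝ} (hb : ∀ r, 0 ≤ b r) {B t : ℕ} (hBt : B ≤ t) (N : ℕ) :
    ∑ u ∈ Finset.Ico t (t + N), ∑ r ∈ Finset.Ico (u - B) u, b r ≤
      B * ∑ r ∈ Finset.Ico (t - B) (t + N), b r := by
  have h1 : ∀ u ∈ Finset.Ico t (t + N), ∑ r ∈ Finset.Ico (u - B) u, b r =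
      ∑ j ∈ Finset.range B, b (u - B + j) := by
    intro u hu
    have : B ≤ u := hBt.trans (Finset.mem_Ico.1 hu).1
    rw [Finset.sum_Ico_eq_sum_range, Nat.sub_sub_self this]
  rw [Finset.sum_congr rfl h1, Finset.sum_comm]
  have h2 : ∀ j ∈ Finset.range B, ∑ u ∈ Finset.Ico t (t + N), b (u - B + j) ≤
      ∑ r ∈ Finset.Ico (t - B) (t + N), b r := by
    intro j hj
    have hj := Finset.mem_range.1 hj
    have hinj : Set.InjOn (fun u => u - B + j) (Finset.Ico t (t + N) : Set ℕ) := by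
      intro u hu v hv huv
      simp only [Finset.coe_Ico, Set.mem_Ico] at hu hv huv
      omega
    rw [← Finset.sum_image (f := b) hinj]
    refine Finset.sum_le_sum_of_subset_of_nonneg ?_ fun r _ _ => hb r
    intro r hr
    obtain ⟨u, hu, rfl⟩ := Finset.mem_image.1 hr
    rw [Finset.mem_Ico] at hu ⊢
    omega
  simpa using Finset.sum_le_sum h2

theorem le_add_of_delayed_recursion {a b : ℕ → ℝ} (hb : ∀ r, 0 ≤ b r) {B t : ℕ} (hBt : B ≤ t)
    {c d : ℝ} (hd : 0 ≤ d)
    (hstep : ∀ u, a (u + 1) ≤ a u + c * b u + d * ∑ r ∈ Finset.Ico (u - B) u, b r) (N : ℕ) :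
    a (t + N) ≤ a t + d * B * ∑ r ∈ Finset.Ico (t - B) t, b r +
      (c + d * B) * ∑ r ∈ Finset.Ico t (t + N), b r := by
  have h : a (t + N) - a t ≤ c * ∑ u ∈ Finset.Ico t (t + N), b u +
      d * ∑ u ∈ Finset.Ico t (t + N), ∑ r ∈ Finset.Ico (u - B) u, b r := by
    rw [← Finset.sum_Ico_sub a (Nat.le_add_right t N), Finset.mul_sum, Finset.mul_sum,
      ← Finset.sum_add_distrib]
    exact Finset.sum_le_sum fun u _ => by linarith [hstep u]
  have hw := mul_le_mul_of_nonneg_left (sum_window_sums_le hb hBt N) hd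
  rw [← Finset.sum_Ico_consecutive b (Nat.sub_le t B) (Nat.le_add_right t N)] at hw
  linarith

/-- If `v` is, block by block, either zero or minus a gradient estimate `G i` within
`K * ∑ r ∈ S, ‖u r‖` of `g`, then `v` is almost a descent direction for `g`. -/
theorem inner_le_of_block_estimates {m n : ℕ} {κ : Type*} (blk : Fin m → Fin n) (A : Set (Fin n))
    (g v : EuclideanSpace ℝ (Fin m)) (G : Fin n → EuclideanSpace ℝ (Fin m))
    (hv : ∀ c, v c = if blk c ∈ A then -(G (blk c) c) else 0)
    (S : Finset κ) (u : κ → EuclideanSpace ℝ (Fin m)) {K : ℝ} (hK : 0 ≤ K)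
    (hG : ∀ i ∈ A, ‖g - G i‖ ≤ K * ∑ r ∈ S, ‖u r‖) :
    inner ℝ g v ≤ -‖v‖ ^ 2 +
      K / 2 * (n * ∑ r ∈ S, ‖u r‖ ^ 2 + S.card * ‖v‖ ^ 2) := by
  have hsplit : inner ℝ g v = -‖v‖ ^ 2 + ∑ i, inner ℝ (g - G i) (blockRestrict blk i v) := by
    rw [sum_inner_blockRestrict blk (fun i => g - G i), EuclideanSpace.norm_sq_eq,
      ← Finset.sum_neg_distrib, ← Finset.sum_add_distrib, PiLp.inner_apply]
    refine Finset.sum_congr rfl fun c _ => ?_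
    simp only [PiLp.sub_apply, Real.norm_eq_abs, sq_abs, RCLike.inner_apply, conj_trivial]
    rw [hv c]
    split_ifs <;> ring
  have hblock : ∀ i, inner ℝ (g - G i) (blockRestrict blk i v) ≤
      K / 2 * (∑ r ∈ S, ‖u r‖ ^ 2 + S.card * ‖blockRestrict blk i v‖ ^ 2) := by
    intro i
    by_cases hi : i ∈ A
    · calc _ ≤ ‖g - G i‖ * ‖blockRestrict blk i v‖ := real_inner_le_norm _ _
        _ ≤ (K * ∑ r ∈ S, ‖u r‖) * ‖blockRestrict blk i v‖ := by
          gcongr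
          exact hG i hi
        _ = K / 2 * ∑ r ∈ S, 2 * ‖u r‖ * ‖blockRestrict blk i v‖ := by
          simp only [mul_assoc, ← Finset.mul_sum, Finset.sum_mul]
          ring
        _ ≤ K / 2 * ∑ r ∈ S, (‖u r‖ ^ 2 + ‖blockRestrict blk i v‖ ^ 2) := by
          gcongr
          exact two_mul_le_add_sq _ _
        _ = _ := by simp [Finset.sum_add_distrib]
    · have h0 : blockRestrict blk i v = 0 := by
        ext c
        simp only [blockRestrict, PiLp.zero_apply]
        split_ifs with hc
        · rw [hv c, hc, if_neg hi]
        · rfl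
      rw [h0, inner_zero_right]
      positivity
  have hsum := Finset.sum_le_sum fun i (_ : i ∈ Finset.univ) => hblock i
  rw [← Finset.mul_sum, Finset.sum_add_distrib, ← Finset.mul_sum, sum_norm_sq_blockRestrict,
    Finset.sum_const, Finset.card_univ, Fintype.card_fin, nsmul_eq_mul] at hsum
  linarith

theorem alpha_kB_bound
    (m n B : ℕ) (hn : 0 < n) (hB : 1 ≤ B)
    (f : EuclideanSpace ℝ (Fin m) → ℝ) (μ L γ fstar : ℝ)
    (hμ : 0 < μ) (hL : 0 < L) (hγ : 0 < γ)
    (hdiff : Differentiable ℝ f)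
    (hmin : ∀ z, fstar ≤ f z) (hattain : ∃ z, f z = fstar)
    (hPL : ∀ z, μ * (f z - fstar) ≤ (1 / 2) * ‖gradient f z‖ ^ 2)
    (hLip : ∀ y z, ‖gradient f z - gradient f y‖ ≤ L * ‖z - y‖)
    (hstatfin : {z : EuclideanSpace ℝ (Fin m) | gradient f z = 0}.Finite)
    (hstatne : {z : EuclideanSpace ℝ (Fin m) | gradient f z = 0}.Nonempty)
    (blk : Fin m → Fin n) (T : Fin n → Set ℕ) (τ : Fin n → Fin n → ℕ → ℕ)
    (X : Fin n → ℕ → EuclideanSpace ℝ (Fin m))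
    (x s : ℕ → EuclideanSpace ℝ (Fin m))
    (hτle : ∀ i j t, τ i j t ≤ t)
    (hread : ∀ i j, j ≠ i → ∀ t c, blk c = j → X i t c = X j (τ i j t) c)
    (hupd : ∀ i t c, blk c = i →
      X i (t + 1) c = if t ∈ T i then X i t c - γ * gradient f (X i t) c else X i t c)
    (hx : ∀ t c, x t c = X (blk c) t c)
    (hs : ∀ t c, s t c = if t ∈ T (blk c) then -(gradient f (X (blk c) t) c) else 0)
    (hasync1 : ∀ i t, ∃ t' ∈ Finset.Ico t (t + B), t' ∈ T i)
    (hasync2 : ∀ i j t, t ∈ T i → j ≠ i → t < τ i j t + B)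
    (alpha beta : ℕ → ℝ)
    (halpha : ∀ t, alpha t = f (x t) - fstar)
    (hbeta : ∀ t, beta t = γ ^ 2 * ∑ τ' ∈ Finset.Ico (t - B) t, ‖s τ'‖ ^ 2)
    (hγ13 : γ < 1 / (L * ((B : ℝ) / 2) * ((n : ℝ) + 1) + L + (L / 2) * (n : ℝ) * (B : ℝ))) :
    ∀ t : ℕ, B ≤ t → ∀ k : ℕ, 1 ≤ k →
      alpha (t + k * B) ≤ alpha t + (L / 2) * (n : ℝ) * (B : ℝ) * beta t +
        (L * (((B : ℝ) / 2) * ((n : ℝ) + 1) + 1) - γ⁻¹ + (L / 2) * (n : ℝ) * (B : ℝ)) *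
          beta (t + B) := by
  intro t hBt k hk
  have hstate : ∀ u, x (u + 1) = x u + γ • s u := by
    intro u
    ext c
    simp only [PiLp.add_apply, PiLp.smul_apply, smul_eq_mul]
    rw [hx, hx, hs, hupd _ u c rfl]
    split_ifs <;> ring
  have hdelay : ∀ i u, u ∈ T i →
      ‖x u - X i u‖ ≤ ∑ r ∈ Finset.Ico (u - B) u, ‖γ • s r‖ := by
    intro i u hu
    refine EuclideanSpace.norm_le_sum_norm_of_abs_le _ _ _ fun c => ?_
    rw [PiLp.sub_apply]
    by_cases hc : blk c = i
    · rw [hx, hc, sub_self, abs_zero]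
      positivity
    · have hτ := hasync2 i (blk c) u hu hc
      rw [hread i (blk c) hc u c rfl, ← hx,
        ← Finset.sum_Ico_sub (fun r => x r c) (hτle i (blk c) u)]
      refine (Finset.abs_sum_le_sum_abs _ _).trans ?_
      simp only [hstate, PiLp.add_apply, add_sub_cancel_left]
      exact Finset.sum_le_sum_of_subset_of_nonneg
        (Finset.Ico_subset_Ico_left (by omega)) fun _ _ _ => abs_nonneg _
  have hstep : ∀ u, alpha (u + 1) ≤ alpha u +
      (L * ((B : ℝ) / 2 + 1) - γ⁻¹) * (γ ^ 2 * ‖s u‖ ^ 2) +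
      L / 2 * n * ∑ r ∈ Finset.Ico (u - B) u, γ ^ 2 * ‖s r‖ ^ 2 := by
    intro u
    have hdesc := le_add_inner_gradient_add_sq hL.le hdiff hLip (x u) (γ • s u)
    have hin := inner_le_of_block_estimates blk {i | u ∈ T i} (gradient f (x u)) (s u)
      (fun i => gradient f (X i u)) (hs u) (Finset.Ico (u - B) u) s
      (K := L * γ) (by positivity) (fun i hi => by
        refine (hLip _ _).trans ?_
        rw [mul_assoc, Finset.mul_sum]
        refine mul_le_mul_of_nonneg_left ((hdelay i u hi).trans_eq ?_) hL.le
        simp only [norm_smul, Real.norm_of_nonneg hγ.le])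
    have hcard : ((Finset.Ico (u - B) u).card : ℝ) ≤ B := by
      rw [Nat.card_Ico]
      exact_mod_cast (by omega : u - (u - B) ≤ B)
    have hcard' : ((Finset.Ico (u - B) u).card : ℝ) * (L * γ ^ 2 / 2 * ‖s u‖ ^ 2) ≤
        B * (L * γ ^ 2 / 2 * ‖s u‖ ^ 2) := by gcongr
    have hin' := mul_le_mul_of_nonneg_left hin hγ.le
    have hγinv : γ⁻¹ * (γ ^ 2 * ‖s u‖ ^ 2) = γ * ‖s u‖ ^ 2 := by field_simp
    rw [inner_smul_right, norm_smul, Real.norm_of_nonneg hγ.le] at hdesc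
    rw [halpha, halpha, hstate, ← Finset.mul_sum]
    linarith
  have hb : ∀ r, 0 ≤ γ ^ 2 * ‖s r‖ ^ 2 := fun r => by positivity
  have hmain := le_add_of_delayed_recursion hb hBt (by positivity) hstep (k * B)
  have hmono : ∑ r ∈ Finset.Ico t (t + B), γ ^ 2 * ‖s r‖ ^ 2 ≤
      ∑ r ∈ Finset.Ico t (t + k * B), γ ^ 2 * ‖s r‖ ^ 2 :=
    Finset.sum_le_sum_of_subset_of_nonneg
      (Finset.Ico_subset_Ico_right (Nat.add_le_add_left (Nat.le_mul_of_pos_left B hk) t))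
      fun r _ _ => hb r
  have hneg : L * (((B : ℝ) / 2) * ((n : ℝ) + 1) + 1) - γ⁻¹ + (L / 2) * n * B ≤ 0 := by
    have := (lt_one_div hγ (by positivity)).1 hγ13
    rw [one_div] at this
    linarith
  have hcoef : L * ((B : ℝ) / 2 + 1) - γ⁻¹ + L / 2 * n * B ≤
      L * (((B : ℝ) / 2) * ((n : ℝ) + 1) + 1) - γ⁻¹ + (L / 2) * n * B := by
    have : 0 ≤ L * ((B : ℝ) / 2) * n := by positivity
    linarith
  have h1 := mul_le_mul_of_nonneg_right hcoef
    (Finset.sum_nonneg fun r (_ : r ∈ Finset.Ico t (t + k * B)) => hb r)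
  have h2 := mul_le_mul_of_nonpos_left hmono hneg
  simp only [hbeta, Nat.add_sub_cancel]
  simp only [← Finset.mul_sum] at hmain h1 h2
  linarith
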